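/- arXiv:1712.04770 — 5 statements merged into one kernel-verified Lean document; each statement's English description precedes it below -/
import Mathlib

section
/- Let $W$ be a standard normal random variable and let $Z$ be a unit-mean exponential random variable independent of $W$. Then for any constant $c > 0$, $\mathbb{P}(cW - c^2/2 + Z > 0) = 2\,\mathbb{P}(W > c/2)$. -/
open MeasureTheory ProbabilityTheory

lemma exp_tail (t : ℝ) : expMeasure 1 (Set.Ioi t) =
    if 0 ≤ t then ENNReal.ofReal (Real.exp (-t)) else 1 := by
  haveI := isProbabilityMeasure_expMeasure (r := 1) one_pos
  have h := cdf_expMeasure_eq (r := 1) one_pos t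
  rw [cdf_eq_real] at h
  have h2 : (expMeasure 1).real (Set.Ioi t) = 1 - (expMeasure 1).real (Set.Iic t) := by
    rw [← Set.compl_Iic, probReal_compl_eq_one_sub measurableSet_Iic]
  rw [← ENNReal.ofReal_toReal (measure_ne_top (expMeasure 1) (Set.Ioi t))]
  change ENNReal.ofReal ((expMeasure 1).real (Set.Ioi t)) = _
  rw [h2, h]
  split_ifs <;> simp

lemma gauss_tilt (c w : ℝ) :
    gaussianPDF 0 1 w * ENNReal.ofReal (Real.exp (-(c ^ 2 / 2 - c * w))) = gaussianPDF c 1 w := by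
  unfold gaussianPDF
  rw [← ENNReal.ofReal_mul (gaussianPDFReal_nonneg _ _ _)]
  congr 1
  simp only [gaussianPDFReal]
  rw [mul_assoc, ← Real.exp_add]
  congr 2
  push_cast
  ring

theorem sojourn_tilt_prob {Ω : Type*} [MeasurableSpace Ω] (P : Measure Ω)
    [IsProbabilityMeasure P] (W Z : Ω → ℝ)
    (hWmeas : Measurable W) (hZmeas : Measurable Z)
    (hW : P.map W = gaussianReal 0 1)
    (hZ : P.map Z = expMeasure 1)
    (hInd : IndepFun W Z P)
    (c : ℝ) (hc : 0 < c) :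
    P {ω | 0 < c * W ω - c ^ 2 / 2 + Z ω} = 2 * P {ω | c / 2 < W ω} := by
  haveI := isProbabilityMeasure_expMeasure (r := 1) one_pos
  have hmap := (indepFun_iff_map_prod_eq_prod_map_map hWmeas.aemeasurable
    hZmeas.aemeasurable).1 hInd
  rw [hW, hZ] at hmap
  have hS : MeasurableSet {p : ℝ × ℝ | 0 < c * p.1 - c ^ 2 / 2 + p.2} :=
    measurableSet_lt (by fun_prop) (by fun_prop)
  have h1 : P {ω | 0 < c * W ω - c ^ 2 / 2 + Z ω} =
      ∫⁻ w, expMeasure 1 (Set.Ioi (c ^ 2 / 2 - c * w)) ∂(gaussianReal 0 1) := by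
    have : P {ω | 0 < c * W ω - c ^ 2 / 2 + Z ω} =
        (P.map fun ω => (W ω, Z ω)) {p : ℝ × ℝ | 0 < c * p.1 - c ^ 2 / 2 + p.2} := by
      rw [Measure.map_apply (hWmeas.prodMk hZmeas) hS]; rfl
    rw [this, hmap, Measure.prod_apply hS]
    refine lintegral_congr fun w => ?_
    congr 1
    ext z
    simp only [Set.mem_preimage, Set.mem_setOf_eq, Set.mem_Ioi]
    constructor <;> intro h <;> linarith
  have h2 : P {ω | c / 2 < W ω} = gaussianReal 0 1 (Set.Ioi (c / 2)) := by
    rw [← hW, Measure.map_apply hWmeas measurableSet_Ioi]; rfl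
  have h3 : gaussianReal c 1 (Set.Iic (c / 2)) = gaussianReal 0 1 (Set.Ioi (c / 2)) := by
    haveI := nullSingletonClass_gaussianReal (μ := 0) (v := 1) one_ne_zero
    have := gaussianReal_map_const_sub (μ := 0) (v := 1) c
    rw [sub_zero] at this
    rw [← this, Measure.map_apply (by fun_prop) measurableSet_Iic,
      measure_congr (Ioi_ae_eq_Ici (a := c / 2))]
    congr 1
    ext x
    simp only [Set.mem_preimage, Set.mem_Iic, Set.mem_Ici]
    constructor <;> intro h <;> linarith
  rw [h1, h2, two_mul, ← lintegral_add_compl _ (measurableSet_Ioi (a := c / 2)), Set.compl_Ioi]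
  congr 1
  · rw [← setLIntegral_one]
    refine setLIntegral_congr_fun measurableSet_Ioi fun w hw => ?_
    have hw' : c / 2 < w := hw
    simp only [exp_tail]
    rw [if_neg]
    nlinarith
  · rw [← h3, gaussianReal_apply _ one_ne_zero, gaussianReal_of_var_ne_zero _ one_ne_zero,
      setLIntegral_withDensity_eq_setLIntegral_mul_non_measurable _ (measurable_gaussianPDF 0 1)
        _ measurableSet_Iic (Filter.Eventually.of_forall fun _ => gaussianPDF_lt_top)]
    refine setLIntegral_congr_fun measurableSet_Iic fun w hw => ?_
    have hw' : w ≤ c / 2 := hw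
    simp only [Pi.mul_apply, exp_tail]
    rw [if_pos (by nlinarith), gauss_tilt]
end

section
/- Let $W$ be a standard normal random variable and let $Z$ be a unit-mean exponential random variable independent of $W$. Then for any $c > 0$, $\mathbb{P}\big(cW - c^2/2 + Z > 0 \text{ and } cW - c^2/2 \le 0\big) = \mathbb{P}(W \le -c/2)$. -/
open MeasureTheory ProbabilityTheory

lemma expMeasure_Ioi_aux (t : ℝ) (ht : 0 ≤ t) :
    expMeasure 1 (Set.Ioi t) = ENNReal.ofReal (Real.exp (-t)) := by
  have : IsProbabilityMeasure (expMeasure 1) := isProbabilityMeasure_expMeasure one_pos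
  have h1 : (Set.Ioi t) = (Set.Iic t)ᶜ := by simp
  have hle : Real.exp (-t) ≤ 1 := by simpa using ht
  rw [h1, prob_compl_eq_one_sub measurableSet_Iic, ← ofReal_cdf, cdf_expMeasure_eq one_pos,
    if_pos ht, ← ENNReal.ofReal_one, ← ENNReal.ofReal_sub _ (by rw [one_mul]; linarith)]
  congr 1
  ring_nf

theorem sojourn_tilt_prob_neg_part {Ω : Type*} [MeasurableSpace Ω] (P : Measure Ω)
    [IsProbabilityMeasure P] (W Z : Ω → ℝ)
    (hWmeas : Measurable W) (hZmeas : Measurable Z)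
    (hW : P.map W = gaussianReal 0 1)
    (hZ : P.map Z = expMeasure 1)
    (hInd : IndepFun W Z P)
    (c : ℝ) (hc : 0 < c) :
    P {ω | 0 < c * W ω - c ^ 2 / 2 + Z ω ∧ c * W ω - c ^ 2 / 2 ≤ 0}
      = P {ω | W ω ≤ -c / 2} := by
  have : IsProbabilityMeasure (expMeasure 1) := isProbabilityMeasure_expMeasure one_pos
  have hprod := (indepFun_iff_map_prod_eq_prod_map_map hWmeas.aemeasurable
    hZmeas.aemeasurable).1 hInd
  rw [hW, hZ] at hprod
  let S : Set (ℝ × ℝ) := {p | 0 < c * p.1 - c ^ 2 / 2 + p.2 ∧ c * p.1 - c ^ 2 / 2 ≤ 0}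
  have h1 : MeasurableSet {p : ℝ × ℝ | 0 < c * p.1 - c ^ 2 / 2 + p.2} :=
    measurableSet_lt (by fun_prop) (by fun_prop)
  have h2 : MeasurableSet {p : ℝ × ℝ | c * p.1 - c ^ 2 / 2 ≤ 0} :=
    measurableSet_le (by fun_prop) (by fun_prop)
  have hS : MeasurableSet S := h1.inter h2
  have hL : P {ω | 0 < c * W ω - c ^ 2 / 2 + Z ω ∧ c * W ω - c ^ 2 / 2 ≤ 0}
      = ((gaussianReal 0 1).prod (expMeasure 1)) S := by
    rw [← hprod, Measure.map_apply (hWmeas.prodMk hZmeas) hS]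
    rfl
  have hR : P {ω | W ω ≤ -c / 2} = gaussianReal 0 1 (Set.Iic (-c / 2)) := by
    rw [← hW, Measure.map_apply hWmeas measurableSet_Iic]
    rfl
  have hG : gaussianReal 0 1 (Set.Iic (-c / 2)) = gaussianReal c 1 (Set.Iic (c / 2)) := by
    have h := gaussianReal_map_add_const (μ := 0) (v := 1) c
    rw [zero_add] at h
    rw [← h, Measure.map_apply (by fun_prop) measurableSet_Iic]
    congr 1
    ext x
    simp only [Set.mem_Iic, Set.mem_preimage]
    constructor <;> intro h <;> linarith
  rw [hL, hR, hG, Measure.prod_apply hS, gaussianReal_apply c one_ne_zero,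
    gaussianReal_of_var_ne_zero 0 one_ne_zero,
    lintegral_withDensity_eq_lintegral_mul _ (measurable_gaussianPDF 0 1)
      (measurable_measure_prodMk_left hS), ← lintegral_indicator measurableSet_Iic]
  congr 1
  ext x
  simp only [Pi.mul_apply]
  by_cases hx : x ≤ c / 2
  · have hx' : c * x - c ^ 2 / 2 ≤ 0 := by nlinarith
    have hsec : Prod.mk x ⁻¹' S = Set.Ioi (-(c * x - c ^ 2 / 2)) := by
      ext z
      simp only [S, Set.mem_preimage, Set.mem_ofPred_eq, Set.mem_Ioi]
      constructor
      · rintro ⟨h, -⟩; linarith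
      · intro h; exact ⟨by linarith, hx'⟩
    rw [hsec, expMeasure_Ioi_aux _ (by linarith), Set.indicator_of_mem (by exact hx),
      gaussianPDF, gaussianPDF, ← ENNReal.ofReal_mul (gaussianPDFReal_nonneg _ _ _)]
    congr 1
    rw [gaussianPDFReal, gaussianPDFReal, mul_assoc, ← Real.exp_add]
    congr 2
    simp only [NNReal.coe_one]
    ring
  · have hsec : Prod.mk x ⁻¹' S = ∅ := by
      ext z
      simp only [S, Set.mem_preimage, Set.mem_ofPred_eq, Set.mem_empty_iff_false, iff_false]
      rintro ⟨-, h⟩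
      apply hx
      by_contra hlt
      push Not at hlt
      nlinarith
    rw [hsec, Set.indicator_of_notMem (by exact hx)]
    simp
end

section
/- For every $\alpha \in (0,2]$, $\dfrac{\Gamma(1/\alpha)}{4\,\Gamma(2/\alpha)} \ \ge\ \dfrac{4^{-1/\alpha - 1}}{\Gamma(1/\alpha + 1)}$, i.e., the lower bound for the Pickands constant obtained in Theorem 1.1 uniformly improves the lower bound $4^{-1/\alpha-1}/\Gamma(1/\alpha+1)$. -/
theorem pickands_lower_bound_improves (α : ℝ) (hα : α ∈ Set.Ioc (0 : ℝ) 2) :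
    4 ^ (-(1 / α) - 1) / Real.Gamma (1 / α + 1)
      ≤ Real.Gamma (1 / α) / (4 * Real.Gamma (2 / α)) := by
  obtain ⟨h0, h2⟩ := hα
  have hx : (1 / 2 : ℝ) ≤ 1 / α := one_div_le_one_div_of_le h0 h2
  have e2 : 2 / α = 2 * (1 / α) := by ring
  rw [e2]
  generalize 1 / α = x at hx
  have hx0 : 0 < x := by linarith
  have hG := Real.Gamma_pos_of_pos hx0
  have hG1 := Real.Gamma_pos_of_pos (show 0 < x + 1 by linarith)
  have hG2 := Real.Gamma_pos_of_pos (show 0 < 2 * x by linarith)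
  have hdup := Real.Gamma_mul_Gamma_add_half x
  have hadd := Real.Gamma_add_one hx0.ne'
  have hconv := Real.convexOn_Gamma.2 (show x ∈ Set.Ioi (0 : ℝ) from hx0)
    (show x + 1 ∈ Set.Ioi (0 : ℝ) from Set.mem_Ioi.2 (by linarith))
    (show (0 : ℝ) ≤ 1 / 2 by norm_num) (show (0 : ℝ) ≤ 1 / 2 by norm_num) (by norm_num)
  simp only [smul_eq_mul] at hconv
  rw [show 1 / 2 * x + 1 / 2 * (x + 1) = x + 1 / 2 by ring] at hconv
  have hpi : (1 : ℝ) ≤ √Real.pi := by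
    rw [Real.one_le_sqrt]; linarith [Real.pi_gt_three]
  have e4 : (4 : ℝ) ^ (-x - 1) = 2 ^ (1 - 2 * x) / 8 := by
    rw [show (4 : ℝ) = 2 ^ (2 : ℝ) by norm_num, ← Real.rpow_mul (by norm_num),
      show (8 : ℝ) = 2 ^ (3 : ℝ) by norm_num, ← Real.rpow_sub (by norm_num)]
    congr 1; ring
  have hp : (0 : ℝ) < 2 ^ (1 - 2 * x) := by positivity
  rw [e4, div_le_div_iff₀ hG1 (by positivity)]
  set p : ℝ := 2 ^ (1 - 2 * x)
  have h1 : Real.Gamma x ≤ 2 * Real.Gamma (x + 1) := by rw [hadd]; nlinarith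
  have h3 : Real.Gamma (x + 1 / 2) ≤ 2 * Real.Gamma (x + 1) := by linarith
  have h4 : Real.Gamma x * Real.Gamma (x + 1 / 2) ≤ Real.Gamma x * (2 * Real.Gamma (x + 1)) :=
    mul_le_mul_of_nonneg_left h3 hG.le
  have h5 : Real.Gamma (2 * x) * p * 1 ≤ Real.Gamma (2 * x) * p * √Real.pi :=
    mul_le_mul_of_nonneg_left hpi (by positivity)
  linarith
end

section
/- Let $W$ be a standard normal random variable and let $Z$ be a unit-mean exponential random variable independent of $W$. Then $\mathbb{E}\big[(2W^2 + 4Z)^{-1/2}\big] = \dfrac{1}{\sqrt{\pi}}$. (This is the representation $\mathcal{H}_2 = \mathbb{E}[1/I_2]$ of Theorem 1.1 in the case $\alpha = 2$, where $I_2 = \mathrm{Leb}\{t \in \mathbb{R} : \sqrt{2}\,tW - t^2 + Z > 0\} = \sqrt{2W^2 + 4Z}$ and $\mathcal{H}_2 = 1/\sqrt{\pi}$ is the Pickands constant for $\alpha = 2$.) -/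
open MeasureTheory ProbabilityTheory

lemma aux_nonneg (x : ℝ) : 0 ≤ x ^ (-(1 / 2) : ℝ) := by
  rcases le_or_gt 0 x with h | h
  · positivity
  · rw [Real.rpow_def_of_neg h]
    have : Real.cos (-(1 / 2) * Real.pi) = 0 := by
      rw [show -(1 / 2) * Real.pi = -(Real.pi / 2) by ring, Real.cos_neg, Real.cos_pi_div_two]
    rw [this, mul_zero]

lemma aux_pos (x : ℝ) (h : 0 ≤ x) : (4 * x) ^ (-(1 / 2) : ℝ) = (2 * √x)⁻¹ := by
  rw [Real.rpow_neg (by positivity), ← Real.sqrt_eq_rpow, Real.sqrt_mul (by norm_num)]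
  rw [show (4 : ℝ) = 2 ^ 2 by norm_num, Real.sqrt_sq (by norm_num)]

noncomputable def auxK (y : ℝ) : ENNReal :=
  ENNReal.ofReal (Real.exp (-y) * (2 * √y)⁻¹ * (√(2 * Real.pi))⁻¹)

lemma aux_point (w y : ℝ) :
    gaussianPDF 0 1 w * (exponentialPDF 1 (y - w ^ 2 / 2) *
      ENNReal.ofReal ((2 * w ^ 2 + 4 * (y - w ^ 2 / 2)) ^ (-(1 / 2) : ℝ)))
      = {p : ℝ × ℝ | p.1 ^ 2 ≤ 2 * p.2}.indicator (fun p => auxK p.2) (w, y) := by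
  by_cases h : w ^ 2 ≤ 2 * y
  · rw [Set.indicator_of_mem (by simpa using h)]
    have hy : 0 ≤ y := by nlinarith [sq_nonneg w]
    rw [exponentialPDF_of_nonneg (by linarith), gaussianPDF, gaussianPDFReal, auxK,
      show 2 * w ^ 2 + 4 * (y - w ^ 2 / 2) = 4 * y by ring, aux_pos y hy,
      ← ENNReal.ofReal_mul (by positivity), ← ENNReal.ofReal_mul (by positivity)]
    congr 1
    have : Real.exp (-y) = Real.exp (-(w - 0) ^ 2 / (2 * ((1 : NNReal) : ℝ)))
        * Real.exp (-(1 * (y - w ^ 2 / 2))) := by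
      rw [← Real.exp_add]; congr 1; simp; ring
    rw [this]; simp; ring
  · rw [Set.indicator_of_notMem (by simpa using h), exponentialPDF_of_neg (by linarith)]
    simp

lemma aux_vol (y : ℝ) : volume {w : ℝ | w ^ 2 ≤ 2 * y} = ENNReal.ofReal (2 * √(2 * y)) := by
  rcases le_or_gt 0 y with h | h
  · have : {w : ℝ | w ^ 2 ≤ 2 * y} = Set.Icc (-√(2 * y)) (√(2 * y)) := by
      ext w; simp only [Set.mem_ofPred_eq, Set.mem_Icc]
      rw [Real.sq_le (by linarith)]
    rw [this, Real.volume_Icc]; congr 1; ring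
  · have : {w : ℝ | w ^ 2 ≤ 2 * y} = ∅ := by
      ext w; simp; nlinarith [sq_nonneg w]
    rw [this, Real.sqrt_eq_zero_of_nonpos (by linarith)]; simp

lemma aux_final (y : ℝ) (h : y ≠ 0) : auxK y * ENNReal.ofReal (2 * √(2 * y)) =
    ENNReal.ofReal (1 / √Real.pi) * exponentialPDF 1 y := by
  rcases lt_or_gt_of_ne h with h | h
  · rw [exponentialPDF_of_neg h, Real.sqrt_eq_zero_of_nonpos (by linarith)]; simp
  · rw [exponentialPDF_of_nonneg h.le, auxK, ← ENNReal.ofReal_mul (by positivity),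
      ← ENNReal.ofReal_mul (by positivity)]
    congr 1
    have h1 : √y ≠ 0 := by positivity
    have h2 : √Real.pi ≠ 0 := by positivity
    rw [Real.sqrt_mul (by norm_num), Real.sqrt_mul (by norm_num)]
    simp only [one_mul]
    field_simp

lemma aux_meas : Measurable fun p : ℝ × ℝ =>
    ENNReal.ofReal ((2 * p.1 ^ 2 + 4 * p.2) ^ (-(1 / 2) : ℝ)) := by
  fun_prop

lemma aux_exp_meas : Measurable (exponentialPDF 1) :=
  (measurable_exponentialPDFReal 1).ennreal_ofReal

lemma aux_main : ∫⁻ w, ∫⁻ z, ENNReal.ofReal ((2 * w ^ 2 + 4 * z) ^ (-(1 / 2) : ℝ))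
    ∂(expMeasure 1) ∂(gaussianReal 0 1) = ENNReal.ofReal (1 / √Real.pi) := by
  have hE : expMeasure 1 = volume.withDensity (exponentialPDF 1) := rfl
  have hin (w : ℝ) : ∫⁻ z, ENNReal.ofReal ((2 * w ^ 2 + 4 * z) ^ (-(1 / 2) : ℝ)) ∂(expMeasure 1)
      = ∫⁻ y, exponentialPDF 1 (y - w ^ 2 / 2) *
      ENNReal.ofReal ((2 * w ^ 2 + 4 * (y - w ^ 2 / 2)) ^ (-(1 / 2) : ℝ)) := by
    rw [hE, lintegral_withDensity_eq_lintegral_mul _ aux_exp_meas (by fun_prop)]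
    rw [← lintegral_sub_right_eq_self _ (w ^ 2 / 2)]
    rfl
  have hm : Measurable fun p : ℝ × ℝ => exponentialPDF 1 (p.2 - p.1 ^ 2 / 2) *
      ENNReal.ofReal ((2 * p.1 ^ 2 + 4 * (p.2 - p.1 ^ 2 / 2)) ^ (-(1 / 2) : ℝ)) :=
    (aux_exp_meas.comp (by fun_prop)).mul (by fun_prop)
  have hS : MeasurableSet {p : ℝ × ℝ | p.1 ^ 2 ≤ 2 * p.2} :=
    measurableSet_le (by fun_prop) (by fun_prop)
  have hK : Measurable auxK := by unfold auxK; fun_prop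
  simp_rw [hin]
  rw [gaussianReal_of_var_ne_zero 0 one_ne_zero,
    lintegral_withDensity_eq_lintegral_mul _ (measurable_gaussianPDF 0 1) hm.lintegral_prod_right']
  have : ∀ w : ℝ, (gaussianPDF 0 1 * fun w : ℝ => ∫⁻ y, exponentialPDF 1 (y - w ^ 2 / 2) *
      ENNReal.ofReal ((2 * w ^ 2 + 4 * (y - w ^ 2 / 2)) ^ (-(1 / 2) : ℝ))) w =
      ∫⁻ y, {p : ℝ × ℝ | p.1 ^ 2 ≤ 2 * p.2}.indicator (fun p => auxK p.2) (w, y) := by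
    intro w
    simp_rw [← aux_point]
    exact (lintegral_const_mul _ (hm.comp measurable_prodMk_left)).symm
  simp_rw [this]
  rw [lintegral_lintegral_swap (f := fun w y =>
    {p : ℝ × ℝ | p.1 ^ 2 ≤ 2 * p.2}.indicator (fun p => auxK p.2) (w, y))
    ((hK.comp measurable_snd).indicator hS).aemeasurable]
  have h2 (y : ℝ) : ∫⁻ w, {p : ℝ × ℝ | p.1 ^ 2 ≤ 2 * p.2}.indicator (fun p => auxK p.2) (w, y)
      = auxK y * ENNReal.ofReal (2 * √(2 * y)) := by
    rw [← aux_vol, ← lintegral_indicator_const (measurableSet_le (by fun_prop) (by fun_prop))]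
    rfl
  simp_rw [h2]
  rw [lintegral_congr_ae (g := fun y => ENNReal.ofReal (1 / √Real.pi) * exponentialPDF 1 y),
    lintegral_const_mul _ aux_exp_meas, lintegral_exponentialPDF_eq_one one_pos, mul_one]
  filter_upwards [Measure.ae_ne volume (0 : ℝ)] with y hy using aux_final y hy

theorem pickands_two_representation {Ω : Type*} [MeasurableSpace Ω] (P : Measure Ω)
    [IsProbabilityMeasure P] (W Z : Ω → ℝ)
    (hWmeas : Measurable W) (hZmeas : Measurable Z)
    (hW : P.map W = gaussianReal 0 1)
    (hZ : P.map Z = expMeasure 1)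
    (hInd : IndepFun W Z P) :
    ∫ ω, (2 * W ω ^ 2 + 4 * Z ω) ^ (-(1 / 2) : ℝ) ∂P = 1 / Real.sqrt Real.pi := by
  have := isProbabilityMeasure_expMeasure (r := 1) one_pos
  rw [integral_eq_lintegral_of_nonneg_ae (Filter.Eventually.of_forall fun _ => aux_nonneg _)
    (Measurable.aestronglyMeasurable (by fun_prop))]
  have h1 := (indepFun_iff_map_prod_eq_prod_map_map hWmeas.aemeasurable hZmeas.aemeasurable).1 hInd
  have h2 := lintegral_map (μ := P) aux_meas (hWmeas.prodMk hZmeas)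
  rw [h1, hW, hZ, lintegral_prod _ aux_meas.aemeasurable, aux_main] at h2
  rw [← h2, ENNReal.toReal_ofReal (by positivity)]
end

section
/- Let $W$ be a standard normal random variable and let $Z$ be a unit-mean exponential random variable independent of $W$. Then $\mathbb{E}\big[\sqrt{2W^2 + 4Z}\big] = \dfrac{4}{\sqrt{\pi}}$. (This is the identity $\mathbb{E}[I_\alpha] = 4\Gamma(2/\alpha)/\Gamma(1/\alpha)$ from the proof of Theorem 1.1 in the case $\alpha = 2$, where $I_2 = \mathrm{Leb}\{t \in \mathbb{R} : \sqrt{2}\,tW - t^2 + Z > 0\} = \sqrt{2W^2+4Z}$.) -/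
open MeasureTheory ProbabilityTheory

/-- The joint integrand after the change of variables `s = w ^ 2 / 2 + z`. -/
noncomputable def sojournKernel (w s : ℝ) : ENNReal :=
  Set.indicator {p : ℝ × ℝ | p.1 ^ 2 / 2 ≤ p.2}
    (fun p => ENNReal.ofReal ((Real.sqrt (2 * Real.pi))⁻¹ * (2 * Real.sqrt p.2 * Real.exp (-p.2))))
    (w, s)

lemma sojournKernel_measurable : Measurable (fun p : ℝ × ℝ => sojournKernel p.1 p.2) := by
  unfold sojournKernel
  refine Measurable.indicator (by fun_prop) ?_
  exact measurableSet_le (by fun_prop) (by fun_prop)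

lemma sojourn_inner (w : ℝ) :
    gaussianPDF 0 1 w * ∫⁻ z, exponentialPDF 1 z *
      ENNReal.ofReal (Real.sqrt (2 * w ^ 2 + 4 * z)) = ∫⁻ s, sojournKernel w s := by
  rw [← lintegral_sub_right_eq_self _ (w ^ 2 / 2), ← lintegral_const_mul']
  swap
  · exact gaussianPDF_ne_top
  refine lintegral_congr fun s => ?_
  have h4 : 2 * w ^ 2 + 4 * (s - w ^ 2 / 2) = 2 ^ 2 * s := by ring
  rw [h4, Real.sqrt_mul (by positivity), Real.sqrt_sq (by norm_num), exponentialPDF_eq]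
  by_cases h : w ^ 2 / 2 ≤ s
  · have h' : 0 ≤ s - w ^ 2 / 2 := by linarith
    rw [if_pos h', sojournKernel, Set.indicator_of_mem (by simpa using h), gaussianPDF,
      ← ENNReal.ofReal_mul (by positivity), ← ENNReal.ofReal_mul (gaussianPDFReal_nonneg _ _ _)]
    congr 1
    rw [gaussianPDFReal]
    have he : Real.exp (-s) = Real.exp (-(w - 0) ^ 2 / (2 * ((1 : NNReal) : ℝ))) *
        Real.exp (-(1 * (s - w ^ 2 / 2))) := by
      rw [← Real.exp_add]; congr 1; push_cast; ring
    rw [he]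
    push_cast
    ring_nf
  · have h' : ¬ 0 ≤ s - w ^ 2 / 2 := by linarith
    rw [if_neg h', sojournKernel, Set.indicator_of_notMem (by simpa using h)]
    simp

lemma sojourn_outer (s : ℝ) :
    ∫⁻ w, sojournKernel w s = ENNReal.ofReal (4 / Real.sqrt Real.pi) * gammaPDF 2 1 s := by
  have e : (fun w => sojournKernel w s) = Set.indicator {w : ℝ | w ^ 2 / 2 ≤ s}
      (fun _ => ENNReal.ofReal
        ((Real.sqrt (2 * Real.pi))⁻¹ * (2 * Real.sqrt s * Real.exp (-s)))) := by
    funext w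
    simp [sojournKernel, Set.indicator]
  have hm : MeasurableSet {w : ℝ | w ^ 2 / 2 ≤ s} :=
    measurableSet_le (by fun_prop) (by fun_prop)
  rw [e, lintegral_indicator_const hm]
  by_cases hs : 0 ≤ s
  · have hset : {w : ℝ | w ^ 2 / 2 ≤ s} = Set.Icc (-Real.sqrt (2 * s)) (Real.sqrt (2 * s)) := by
      ext w
      rw [Set.mem_setOf_eq, Set.mem_Icc, ← Real.sq_le (by positivity)]
      constructor <;> intro h <;> linarith
    rw [hset, Real.volume_Icc, gammaPDF_of_nonneg hs, ← ENNReal.ofReal_mul (by positivity),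
      ← ENNReal.ofReal_mul (by positivity)]
    congr 1
    have hg : Real.Gamma 2 = 1 := by
      simp [Real.Gamma_two]
    rw [hg, Real.sqrt_mul (by norm_num), Real.sqrt_mul (by norm_num)]
    have h1 : (2 : ℝ) - 1 = 1 := by norm_num
    rw [h1, Real.rpow_one, Real.one_rpow, one_mul]
    have h2 : Real.sqrt 2 ≠ 0 := by positivity
    have h3 : Real.sqrt Real.pi ≠ 0 := by positivity
    have h5 : Real.sqrt s * Real.sqrt s = s := Real.mul_self_sqrt hs
    field_simp
    rw [show Real.sqrt s ^ 2 = s by rw [sq, h5]]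
    ring
  · have hset : {w : ℝ | w ^ 2 / 2 ≤ s} = ∅ := by
      ext w
      simp only [Set.mem_setOf_eq, Set.mem_empty_iff_false, iff_false]
      intro h
      have := sq_nonneg w
      linarith
    rw [hset, gammaPDF_of_neg (by linarith)]
    simp

theorem expected_sojourn_alpha_two {Ω : Type*} [MeasurableSpace Ω] (P : Measure Ω)
    [IsProbabilityMeasure P] (W Z : Ω → ℝ)
    (hWmeas : Measurable W) (hZmeas : Measurable Z)
    (hW : P.map W = gaussianReal 0 1)
    (hZ : P.map Z = expMeasure 1)
    (hInd : IndepFun W Z P) :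
    ∫ ω, Real.sqrt (2 * W ω ^ 2 + 4 * Z ω) ∂P = 4 / Real.sqrt Real.pi := by
  rw [integral_eq_lintegral_of_nonneg_ae (Filter.Eventually.of_forall fun _ => Real.sqrt_nonneg _)
    (Measurable.aestronglyMeasurable (by fun_prop))]
  have hf : Measurable (fun p : ℝ × ℝ =>
      ENNReal.ofReal (Real.sqrt (2 * p.1 ^ 2 + 4 * p.2))) := by fun_prop
  have : ∫⁻ ω, ENNReal.ofReal (Real.sqrt (2 * W ω ^ 2 + 4 * Z ω)) ∂P =
      ENNReal.ofReal (4 / Real.sqrt Real.pi) := by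
    haveI : IsProbabilityMeasure (expMeasure 1) := isProbabilityMeasure_expMeasure one_pos
    have hmap := (indepFun_iff_map_prod_eq_prod_map_map hWmeas.aemeasurable
      hZmeas.aemeasurable).1 hInd
    have h1 := lintegral_map (μ := P) hf (hWmeas.prodMk hZmeas)
    rw [← h1, hmap, hW, hZ, lintegral_prod _ hf.aemeasurable,
      gaussianReal_of_var_ne_zero _ one_ne_zero,
      lintegral_withDensity_eq_lintegral_mul _ (measurable_gaussianPDF 0 1)
        hf.lintegral_prod_right']
    have hE : expMeasure 1 = volume.withDensity (exponentialPDF 1) := rfl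
    have hEm : Measurable (exponentialPDF 1) :=
      (measurable_exponentialPDFReal 1).ennreal_ofReal
    have h2 : ∀ w : ℝ, (gaussianPDF 0 1 * fun w => ∫⁻ z,
        ENNReal.ofReal (Real.sqrt (2 * w ^ 2 + 4 * z)) ∂(expMeasure 1)) w
        = ∫⁻ s, sojournKernel w s := by
      intro w
      rw [← sojourn_inner, Pi.mul_apply, hE,
        lintegral_withDensity_eq_lintegral_mul _ hEm (by fun_prop)]
      rfl
    rw [lintegral_congr h2, lintegral_lintegral_swap sojournKernel_measurable.aemeasurable,
      lintegral_congr sojourn_outer, lintegral_const_mul' _ _ ENNReal.ofReal_ne_top,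
      lintegral_gammaPDF_eq_one two_pos one_pos, mul_one]
  rw [this, ENNReal.toReal_ofReal (by positivity)]
end
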